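/- (Dimension bound for games.) For every two-player game G and every integer d ≥ 1, the entangled value restricted to local dimension d satisfies ω*_d(G) ≤ d · ω(G). -/

import Mathlib

open scoped ComplexOrder

/-- The classical value of the two-player game `G`: the best value over deterministic
strategies `f : X → A`, `g : Y → B`. -/
noncomputable def gameCVal {nx ny na nb : ℕ}
    (G : Fin nx → Fin ny → Fin na → Fin nb → ℝ) : ℝ :=
  sSup {r : ℝ | ∃ (f : Fin nx → Fin na) (g : Fin ny → Fin nb),
    r = ∑ x, ∑ y, G x y (f x) (g y)}

/-- The entangled value of the two-player game `G`, restricted to strategies using an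
entangled state of local dimension at most `d` (with arbitrary POVM measurements). -/
noncomputable def gameQValDim {nx ny na nb : ℕ} (d : ℕ)
    (G : Fin nx → Fin ny → Fin na → Fin nb → ℝ) : ℝ :=
  sSup {r : ℝ | ∃ (k : ℕ) (ψ : Fin k × Fin k → ℂ)
      (A : Fin nx → Fin na → Matrix (Fin k) (Fin k) ℂ)
      (B : Fin ny → Fin nb → Matrix (Fin k) (Fin k) ℂ),
    1 ≤ k ∧ k ≤ d ∧ (∑ p, ‖ψ p‖ ^ 2 = 1) ∧
    (∀ x a, (A x a).PosSemidef) ∧ (∀ x, ∑ a, A x a = 1) ∧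
    (∀ y b, (B y b).PosSemidef) ∧ (∀ y, ∑ b, B y b = 1) ∧
    r = (∑ x, ∑ y, ∑ a, ∑ b, (G x y a b : ℂ) *
          ∑ p : Fin k × Fin k, ∑ q : Fin k × Fin k,
            (starRingEnd ℂ) (ψ p) * (A x a p.1 q.1 * B y b p.2 q.2) * ψ q).re}

lemma greedy16 {n m : ℕ} (hm : 0 < m) (p F : Fin n → Fin m → ℝ) (c : ℝ)
    (hp : ∀ x a, 0 ≤ p x a) (hs : ∀ x, ∑ a, p x a = c) :
    ∃ f : Fin n → Fin m, ∑ x, ∑ a, p x a * F x a ≤ c * ∑ x, F x (f x) := by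
  haveI : Nonempty (Fin m) := ⟨⟨0, hm⟩⟩
  have h : ∀ x, ∃ a, ∀ b, F x b ≤ F x a := fun x => Finite.exists_max (F x)
  choose f hf using h
  refine ⟨f, ?_⟩
  rw [Finset.mul_sum]
  refine Finset.sum_le_sum fun x _ => ?_
  rw [← hs x, Finset.sum_mul]
  exact Finset.sum_le_sum fun a _ => mul_le_mul_of_nonneg_left (hf x a) (hp x a)

lemma le_cval16 {nx ny na nb : ℕ} (G : Fin nx → Fin ny → Fin na → Fin nb → ℝ)
    (f : Fin nx → Fin na) (g : Fin ny → Fin nb) :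
    ∑ x, ∑ y, G x y (f x) (g y) ≤ gameCVal G := by
  refine le_csSup ?_ ⟨f, g, rfl⟩
  refine Set.Finite.bddAbove ?_
  refine (Set.finite_range
    (fun fg : (Fin nx → Fin na) × (Fin ny → Fin nb) =>
      ∑ x, ∑ y, G x y (fg.1 x) (fg.2 y))).subset ?_
  rintro r ⟨f, g, rfl⟩
  exact ⟨(f, g), rfl⟩

lemma classical16 {nx ny na nb : ℕ} (G : Fin nx → Fin ny → Fin na → Fin nb → ℝ)
    (ha : 0 < na) (hb : 0 < nb)
    (p : Fin nx → Fin na → ℝ) (q : Fin ny → Fin nb → ℝ) (c : ℝ) (hc : 0 ≤ c)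
    (hp : ∀ x a, 0 ≤ p x a) (hps : ∀ x, ∑ a, p x a = 1)
    (hq : ∀ y b, 0 ≤ q y b) (hqs : ∀ y, ∑ b, q y b = c) :
    ∑ x, ∑ y, ∑ a, ∑ b, G x y a b * (p x a * q y b) ≤ c * gameCVal G := by
  obtain ⟨g, hg⟩ := greedy16 hb q (fun y b => ∑ x, ∑ a, G x y a b * p x a) c hq hqs
  obtain ⟨f, hf⟩ := greedy16 ha p (fun x a => ∑ y, G x y a (g y)) 1 hp hps
  have e1 : ∑ x, ∑ y, ∑ a, ∑ b, G x y a b * (p x a * q y b)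
      = ∑ y, ∑ b, q y b * ∑ x, ∑ a, G x y a b * p x a := by
    rw [Finset.sum_comm]
    refine Finset.sum_congr rfl fun y _ => ?_
    simp_rw [Finset.mul_sum]
    rw [Finset.sum_comm (s := (Finset.univ : Finset (Fin nb)))]
    refine Finset.sum_congr rfl fun x _ => ?_
    rw [Finset.sum_comm]
    refine Finset.sum_congr rfl fun b _ => Finset.sum_congr rfl fun a _ => by ring
  have e2 : ∑ y, ∑ x, ∑ a, G x y a (g y) * p x a
      = ∑ x, ∑ a, p x a * ∑ y, G x y a (g y) := by
    rw [Finset.sum_comm]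
    refine Finset.sum_congr rfl fun x _ => ?_
    rw [Finset.sum_comm]
    refine Finset.sum_congr rfl fun a _ => ?_
    rw [Finset.mul_sum]
    exact Finset.sum_congr rfl fun y _ => by ring
  rw [e1]
  refine hg.trans (mul_le_mul_of_nonneg_left ?_ hc)
  rw [e2]
  refine hf.trans ?_
  rw [one_mul]
  exact le_cval16 G f g

lemma form16 {ι : Type*} [Fintype ι] {k : ℕ} (T : Matrix ι ι ℂ) (hT : T.PosSemidef)
    (w : Fin k → ι → ℂ) :
    (star (∑ i, w i) ⬝ᵥ T.mulVec (∑ i, w i)).re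
      ≤ k * ∑ i, (star (w i) ⬝ᵥ T.mulVec (w i)).re := by
  have h0 : ∀ i j, 0 ≤ (star (w i - w j) ⬝ᵥ T.mulVec (w i - w j)).re := fun i j =>
    (Complex.le_def.1 (hT.dotProduct_mulVec_nonneg (w i - w j))).1
  have h1 : 0 ≤ ∑ i, ∑ j, (star (w i - w j) ⬝ᵥ T.mulVec (w i - w j)).re :=
    Finset.sum_nonneg fun i _ => Finset.sum_nonneg fun j _ => h0 i j
  have h2 : (star (∑ i, w i) ⬝ᵥ T.mulVec (∑ i, w i)).re
      = ∑ i, ∑ j, (star (w i) ⬝ᵥ T.mulVec (w j)).re := by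
    rw [star_sum, sum_dotProduct, Complex.re_sum]
    refine Finset.sum_congr rfl fun i _ => ?_
    rw [Matrix.mulVec_sum, dotProduct_sum, Complex.re_sum]
  have h3 : ∑ i, ∑ j, (star (w j) ⬝ᵥ T.mulVec (w i)).re
      = ∑ i, ∑ j, (star (w i) ⬝ᵥ T.mulVec (w j)).re := Finset.sum_comm
  simp only [star_sub, Matrix.mulVec_sub, sub_dotProduct, dotProduct_sub, Complex.sub_re,
    Finset.sum_sub_distrib, Finset.sum_const, Finset.card_univ, Fintype.card_fin,
    nsmul_eq_mul, ← Finset.mul_sum] at h1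
  rw [h2]
  linarith

lemma key16 {k : ℕ} (A B : Matrix (Fin k) (Fin k) ℂ) (hA : A.PosSemidef) (hB : B.PosSemidef)
    (ψ : Fin k × Fin k → ℂ) :
    (∑ p : Fin k × Fin k, ∑ q : Fin k × Fin k,
            (starRingEnd ℂ) (ψ p) * (A p.1 q.1 * B p.2 q.2) * ψ q).re
    ≤ k * ∑ i, (A i i).re *
        (star (fun j => ψ (i, j)) ⬝ᵥ B.mulVec (fun j => ψ (i, j))).re := by
  have h := form16 (Matrix.kronecker A B) (hA.kronecker hB)
    (fun i p => if p.1 = i then ψ p else 0)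
  have hs : (∑ i : Fin k, fun p : Fin k × Fin k => if p.1 = i then ψ p else 0) = ψ := by
    ext p
    simp
  have e1 : star ψ ⬝ᵥ (Matrix.kronecker A B).mulVec ψ = ∑ p : Fin k × Fin k,
      ∑ q : Fin k × Fin k, (starRingEnd ℂ) (ψ p) * (A p.1 q.1 * B p.2 q.2) * ψ q := by
    simp only [dotProduct, Matrix.mulVec, Finset.mul_sum]
    refine Finset.sum_congr rfl fun p _ => Finset.sum_congr rfl fun q _ => ?_
    simp [Matrix.kronecker, Matrix.kroneckerMap_apply, mul_assoc]
  have e2 : ∀ i : Fin k, star (fun p : Fin k × Fin k => if p.1 = i then ψ p else 0) ⬝ᵥ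
      (Matrix.kronecker A B).mulVec (fun p => if p.1 = i then ψ p else 0)
      = A i i * (star (fun j => ψ (i, j)) ⬝ᵥ B.mulVec (fun j => ψ (i, j))) := by
    intro i
    simp only [dotProduct, Matrix.mulVec, Finset.mul_sum, Fintype.sum_prod_type,
      Matrix.kronecker, Matrix.kroneckerMap_apply, Pi.star_apply, apply_ite star, star_zero,
      ite_mul, mul_ite, mul_zero, zero_mul, Finset.sum_ite_irrel, Finset.sum_const_zero,
      Finset.sum_ite_eq', Finset.mem_univ, if_true, Finset.sum_ite_eq]
    refine Finset.sum_congr rfl fun p _ => Finset.sum_congr rfl fun q _ => ?_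
    ring
  have e3 : ∀ i : Fin k, (A i i).im = 0 := fun i => by
    have := (Complex.le_def.1 (hA.diag_nonneg (i := i))).2
    simpa using this.symm
  rw [hs, e1] at h
  simp only [e2, Complex.mul_re, e3, zero_mul, sub_zero] at h
  exact h

/-- dimension bound for games: `ω*_d(G) ≤ d · ω(G)` for every
two-player game `G` and every `d ≥ 1`. -/
theorem stmt16 {nx ny na nb : ℕ}
    (G : Fin nx → Fin ny → Fin na → Fin nb → ℝ)
    (hpos : ∀ x y a b, 0 ≤ G x y a b)
    (hnorm : ∑ x, ∑ y, ∑ a, ∑ b, G x y a b = 1)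
    (d : ℕ) (hd : 1 ≤ d) :
    gameQValDim d G ≤ d * gameCVal G := by
  have ha : 0 < na := by
    rcases Nat.eq_zero_or_pos na with h | h
    · subst h; simp at hnorm
    · exact h
  have hb : 0 < nb := by
    rcases Nat.eq_zero_or_pos nb with h | h
    · subst h; simp at hnorm
    · exact h
  have hω : 0 ≤ gameCVal G := by
    refine Real.sSup_nonneg ?_
    rintro r ⟨f, g, rfl⟩
    exact Finset.sum_nonneg fun x _ => Finset.sum_nonneg fun y _ => hpos _ _ _ _
  refine Real.sSup_le ?_ (by positivity)
  rintro r ⟨k, ψ, A, B, hk1, hkd, hψ, hA, hAs, hB, hBs, rfl⟩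
  set q : Fin k → Fin ny → Fin nb → ℝ := fun i y b =>
    (star (fun j => ψ (i, j)) ⬝ᵥ (B y b).mulVec (fun j => ψ (i, j))).re with hq
  have step : ∀ i : Fin k, ∑ x, ∑ y, ∑ a, ∑ b, G x y a b * ((A x a i i).re * q i y b)
      ≤ (∑ j, ‖ψ (i, j)‖ ^ 2) * gameCVal G := by
    intro i
    refine classical16 G ha hb (fun x a => (A x a i i).re) (q i) _
      (Finset.sum_nonneg fun j _ => by positivity) ?_ ?_ ?_ ?_
    · intro x a
      exact (Complex.le_def.1 ((hA x a).diag_nonneg (i := i))).1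
    · intro x
      have := congrArg (fun M => (M i i).re) (hAs x)
      simpa [Matrix.sum_apply] using this
    · intro y b
      exact (Complex.le_def.1 ((hB y b).dotProduct_mulVec_nonneg _)).1
    · intro y
      simp only [hq]
      rw [← Complex.re_sum, ← dotProduct_sum, ← Matrix.sum_mulVec, hBs y, Matrix.one_mulVec]
      simp only [dotProduct, Complex.re_sum, Pi.star_apply]
      refine Finset.sum_congr rfl fun j _ => ?_
      rw [Complex.star_def, mul_comm, Complex.mul_conj, Complex.ofReal_re,
        Complex.normSq_eq_norm_sq]
  have hsum : ∑ i, ∑ j, ‖ψ (i, j)‖ ^ 2 = 1 := by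
    rw [← hψ, Fintype.sum_prod_type]
  calc _ ≤ ∑ x, ∑ y, ∑ a, ∑ b, G x y a b * (k * ∑ i, (A x a i i).re * q i y b) := by
        rw [Complex.re_sum]
        refine Finset.sum_le_sum fun x _ => ?_
        rw [Complex.re_sum]
        refine Finset.sum_le_sum fun y _ => ?_
        rw [Complex.re_sum]
        refine Finset.sum_le_sum fun a _ => ?_
        rw [Complex.re_sum]
        refine Finset.sum_le_sum fun b _ => ?_
        rw [Complex.re_ofReal_mul]
        exact mul_le_mul_of_nonneg_left (key16 _ _ (hA x a) (hB y b) ψ) (hpos _ _ _ _)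
    _ = k * ∑ i, ∑ x, ∑ y, ∑ a, ∑ b, G x y a b * ((A x a i i).re * q i y b) := by
        symm
        rw [Finset.sum_comm, Finset.mul_sum]
        refine Finset.sum_congr rfl fun x _ => ?_
        rw [Finset.sum_comm, Finset.mul_sum]
        refine Finset.sum_congr rfl fun y _ => ?_
        rw [Finset.sum_comm, Finset.mul_sum]
        refine Finset.sum_congr rfl fun a _ => ?_
        rw [Finset.sum_comm, Finset.mul_sum]
        refine Finset.sum_congr rfl fun b _ => ?_
        rw [← Finset.mul_sum]
        ring
    _ ≤ k * ∑ i, (∑ j, ‖ψ (i, j)‖ ^ 2) * gameCVal G :=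
        mul_le_mul_of_nonneg_left (Finset.sum_le_sum fun i _ => step i) (by positivity)
    _ = k * gameCVal G := by rw [← Finset.sum_mul, hsum, one_mul]
    _ ≤ d * gameCVal G := mul_le_mul_of_nonneg_right (by exact_mod_cast hkd) hω
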